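/- arXiv:1810.06034 — 5 statements merged into one kernel-verified Lean document; each statement's English description precedes it below -/
import Mathlib

section
/- For every k ≥ 1 and every n ≥ 0, the set of k-ary planar rooted trees with exactly n internal vertices is finite and its cardinality equals the Fuss–Catalan number FC(k,n) = (1/((k-1)·n+1)) · C(k·n, n). -/
/-- A `k`-ary planar rooted tree: either a leaf, or an internal (node) vertex
with `k` ordered subtrees. -/
inductive PTree (k : ℕ) : Type where
  | leaf : PTree k
  | node : (Fin k → PTree k) → PTree k

/-- The number of internal vertices (occurrences of the `node` constructor). -/
def PTree.internal {k : ℕ} : PTree k → ℕ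
  | .leaf => 0
  | .node f => 1 + ∑ i, (f i).internal

/-- The Fuss–Catalan number `FC(k,n) = (1/((k-1)n+1)) · C(kn, n)` (the division is exact). -/
def FC (k n : ℕ) : ℕ := (k * n).choose n / ((k - 1) * n + 1)

namespace PTree

variable {k : ℕ}

@[simp]
theorem internal_leaf : (leaf : PTree k).internal = 0 := rfl

@[simp]
theorem internal_node (f : Fin k → PTree k) :
    (node f).internal = 1 + ∑ i, (f i).internal := rfl

theorem internal_eq_zero_iff {t : PTree k} : t.internal = 0 ↔ t = leaf := by
  cases t <;> simp

/-- The ordered forests of `m` trees with `n` internal vertices in total. -/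
def forests (k m n : ℕ) : Set (Fin m → PTree k) :=
  {f | ∑ i, (f i).internal = n}

/-- Prepend a leaf to a forest. -/
def consLeaf {m : ℕ} (g : Fin m → PTree k) : Fin (m + 1) → PTree k :=
  Fin.cons leaf g

theorem consLeaf_injective {m : ℕ} : Function.Injective (consLeaf (k := k) (m := m)) :=
  fun _ _ h => (Fin.cons_inj.mp h).2

/-- Graft the first `k` trees of a forest onto a new root. -/
def graft {m : ℕ} (g : Fin (k + m) → PTree k) : Fin (m + 1) → PTree k :=
  Fin.cons (node fun i => g (Fin.castAdd m i)) fun j => g (Fin.natAdd k j)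

theorem graft_injective {m : ℕ} : Function.Injective (graft (k := k) (m := m)) := by
  intro g h hgh
  obtain ⟨hroot, htail⟩ := Fin.cons_inj.mp hgh
  rw [node.injEq] at hroot
  funext i
  induction i using Fin.addCases with
  | left i => exact congrFun hroot i
  | right j => exact congrFun htail j

theorem forests_zero_right (k m : ℕ) : forests k m 0 = {fun _ => leaf} := by
  ext f
  simp [forests, internal_eq_zero_iff, funext_iff]

theorem forests_zero_left (k n : ℕ) : forests k 0 (n + 1) = ∅ := by
  ext f
  simp [forests]

theorem forests_succ_succ (k m n : ℕ) :
    forests k (m + 1) (n + 1) =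
      consLeaf '' forests k m (n + 1) ∪
        graft '' forests k (k + m) n := by
  ext f
  simp only [forests, Set.mem_union, Set.mem_image, Set.mem_ofPred_eq]
  constructor
  · induction f using Fin.consCases with
    | cons t f =>
      intro hf
      simp only [Fin.sum_univ_succ, Fin.cons_zero, Fin.cons_succ] at hf
      cases t with
      | leaf => exact Or.inl ⟨f, by simpa using hf, rfl⟩
      | node g =>
        refine Or.inr ⟨Fin.append g f, ?_, ?_⟩
        · rw [internal_node] at hf
          simp only [Fin.sum_univ_add, Fin.append_left, Fin.append_right]
          omega
        · simp [graft]
  · rintro (⟨g, hg, rfl⟩ | ⟨g, hg, rfl⟩)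
    · simpa [consLeaf, Fin.sum_univ_succ] using hg
    · simp only [Fin.sum_univ_add] at hg
      simp only [graft, Fin.sum_univ_succ, Fin.cons_zero, Fin.cons_succ, internal_node]
      omega

theorem disjoint_consLeaf_graft {m : ℕ} (s : Set (Fin m → PTree k))
    (t : Set (Fin (k + m) → PTree k)) :
    Disjoint (consLeaf '' s)
      (graft '' t) := by
  rw [Set.disjoint_left]
  rintro _ ⟨g, -, rfl⟩ ⟨h, -, hgh⟩
  have hroot := (Fin.cons_inj.mp hgh).1
  cases hroot

theorem forests_finite (k n m : ℕ) : (forests k m n).Finite := by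
  induction n generalizing m with
  | zero => simp [forests_zero_right]
  | succ n ihn =>
    induction m with
    | zero => simp [forests_zero_left]
    | succ m ihm =>
      rw [forests_succ_succ]
      exact (ihm.image _).union ((ihn _).image _)

theorem ncard_forests_succ_succ (k m n : ℕ) :
    (forests k (m + 1) (n + 1)).ncard =
      (forests k m (n + 1)).ncard + (forests k (k + m) n).ncard := by
  rw [forests_succ_succ, Set.ncard_union_eq (disjoint_consLeaf_graft _ _)
      ((forests_finite ..).image _) ((forests_finite ..).image _),
    Set.ncard_image_of_injective _ consLeaf_injective,
    Set.ncard_image_of_injective _ graft_injective]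

theorem mul_ncard_forests (hk : 1 ≤ k) (n m : ℕ) :
    (k * n + m) * (forests k m n).ncard = m * (k * n + m).choose n := by
  induction n generalizing m with
  | zero => simp [forests_zero_right]
  | succ n ihn =>
    induction m with
    | zero => simp [forests_zero_left]
    | succ m ihm =>
      have ihk := ihn (k + m)
      rw [ncard_forests_succ_succ]
      have hM : k * n + (k + m) = k * (n + 1) + m := by ring
      have hn : n ≤ k * (n + 1) + m := by nlinarith
      rw [hM] at ihk
      rw [← add_assoc, Nat.choose_succ_succ]
      have hchoose := Nat.choose_succ_right_eq (k * (n + 1) + m) n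
      have hpos : ((k * (n + 1) + m : ℕ) : ℤ) ≠ 0 := by
        have : 0 < k * (n + 1) + m := by positivity
        exact_mod_cast this.ne'
      generalize (k * (n + 1) + m).choose n = b at *
      generalize (k * (n + 1) + m).choose (n + 1) = a at *
      generalize (forests k m (n + 1)).ncard = x at *
      generalize (forests k (k + m) n).ncard = y at *
      zify [hn] at *
      apply mul_left_cancel₀ hpos
      linear_combination (k * (n + 1) + m + 1 : ℤ) * (ihm + ihk) - k * hchoose

theorem finite_and_ncard_internal_eq (k n : ℕ) :
    {t : PTree k | t.internal = n}.Finite ∧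
      {t : PTree k | t.internal = n}.ncard = (forests k 1 n).ncard := by
  have himage : {t : PTree k | t.internal = n} =
      Equiv.funUnique (Fin 1) (PTree k) '' forests k 1 n := by
    ext t
    rw [Equiv.image_eq_preimage_symm]
    simp [forests]
  rw [himage]
  exact ⟨(forests_finite ..).image _, Set.ncard_image_of_injective _ (Equiv.injective _)⟩

end PTree

/-- For every `k ≥ 1` and `n ≥ 0`, the set of `k`-ary planar rooted trees with exactly
`n` internal vertices is finite, of cardinality the Fuss–Catalan number `FC(k,n)`. -/
theorem card_ptree_internal_eq_fussCatalan (k n : ℕ) (hk : 1 ≤ k) :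
    {t : PTree k | t.internal = n}.Finite ∧
      Nat.card {t : PTree k | t.internal = n} = FC k n := by
  obtain ⟨hfinite, hcard⟩ := PTree.finite_and_ncard_internal_eq k n
  refine ⟨hfinite, ?_⟩
  rw [Nat.card_coe_set_eq, hcard, FC]
  have hforests := PTree.mul_ncard_forests hk n 1
  have hchoose := Nat.choose_mul_succ_eq (k * n) n
  have hsub : k * n + 1 - n = (k - 1) * n + 1 := by
    obtain ⟨l, rfl⟩ := Nat.exists_eq_add_of_le' hk
    rw [Nat.add_sub_cancel, Nat.succ_mul]
    omega
  rw [hsub] at hchoose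
  symm
  apply Nat.div_eq_of_eq_mul_left (by positivity)
  apply Nat.eq_of_mul_eq_mul_right (Nat.succ_pos (k * n))
  rw [Nat.succ_eq_add_one, hchoose, ← one_mul ((k * n + 1).choose n), ← hforests]
  ring
end

section
/- For every k ≥ 1 and every n ≥ 0, the Fuss–Catalan numbers satisfy the recursion FC(k, n+1) = Σ_{ℓ : Fin k → ℕ, ℓ₁+⋯+ℓ_k = n} ∏_{i=1}^{k} FC(k, ℓ_i), where the sum is over all k-tuples of nonnegative integers summing to n. -/
/-- The Raney number `r / (k * n + r) * (k * n + r).choose n`, the `n`-th coefficient of the `r`-th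
power of the generating function of the Fuss–Catalan numbers `FC k`. -/
def raney (k : ℕ) : ℕ → ℕ → ℕ
  | 0, _ => 1
  | n + 1, r => ∑ j ∈ Finset.range r, raney k n (j + k)

theorem raney_zero_left (k r : ℕ) : raney k 0 r = 1 := rfl

theorem raney_succ_zero (k n : ℕ) : raney k (n + 1) 0 = 0 := by
  simp [raney]

theorem raney_succ_succ (k n r : ℕ) :
    raney k (n + 1) (r + 1) = raney k (n + 1) r + raney k n (r + k) := by
  simp [raney, Finset.sum_range_succ]

theorem raney_add (k n r s : ℕ) :
    raney k n (r + s) = ∑ p ∈ Finset.HasAntidiagonal.antidiagonal n, raney k p.1 r * raney k p.2 s := by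
  induction n generalizing r with
  | zero => simp [raney_zero_left]
  | succ n ihn =>
    induction r with
    | zero => simp [Finset.Nat.sum_antidiagonal_succ, raney_zero_left, raney_succ_zero]
    | succ r ihr =>
      rw [Nat.add_right_comm r 1 s, raney_succ_succ, ihr, Nat.add_right_comm r s k, ihn]
      simp only [Finset.Nat.sum_antidiagonal_succ, raney_zero_left, raney_succ_succ, add_mul,
        Finset.sum_add_distrib]
      ring

theorem sum_antidiagonalTuple_succ {M : Type*} [AddCommMonoid M] (m n : ℕ)
    (f : (Fin (m + 1) → ℕ) → M) :
    ∑ l ∈ Finset.Nat.antidiagonalTuple (m + 1) n, f l =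
      ∑ p ∈ Finset.HasAntidiagonal.antidiagonal n,
        ∑ l ∈ Finset.Nat.antidiagonalTuple m p.2, f (Fin.cons p.1 l) := by
  rw [Finset.sum_sigma']
  refine Finset.sum_bij' (fun l _ => ⟨(l 0, ∑ i, Fin.tail l i), Fin.tail l⟩)
    (fun x _ => Fin.cons x.1.1 x.2) ?_ ?_ ?_ ?_ ?_
  · intro l hl
    simpa [Finset.Nat.mem_antidiagonalTuple, Fin.sum_univ_succ, Fin.tail] using hl
  · rintro ⟨⟨a, b⟩, l⟩ h
    simp_all [Finset.Nat.mem_antidiagonalTuple, Fin.sum_univ_succ]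
  · simp
  · rintro ⟨⟨a, b⟩, l⟩ h
    simp_all [Finset.Nat.mem_antidiagonalTuple]
  · simp

theorem sum_antidiagonalTuple_prod_raney_one (k m n : ℕ) :
    ∑ l ∈ Finset.Nat.antidiagonalTuple m n, ∏ i, raney k (l i) 1 = raney k n m := by
  induction m generalizing n with
  | zero => cases n <;> simp [raney_zero_left, raney_succ_zero]
  | succ m ih =>
    rw [sum_antidiagonalTuple_succ]
    simp only [Fin.prod_univ_succ, Fin.cons_zero, Fin.cons_succ, ← Finset.mul_sum, ih]
    rw [← raney_add, add_comm]

theorem add_mul_raney (k n r : ℕ) (hk : 1 ≤ k) :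
    (k * n + r) * raney k n r = r * (k * n + r).choose n := by
  induction n generalizing r with
  | zero => simp [raney_zero_left]
  | succ n ihn =>
    induction r with
    | zero => simp [raney_succ_zero]
    | succ r ihr =>
      have hrec := ihn (r + k)
      rw [show k * n + (r + k) = k * (n + 1) + r by ring] at hrec
      have hchoose := Nat.choose_succ_right_eq (k * (n + 1) + r) n
      have hle : n ≤ k * (n + 1) + r := by nlinarith
      have hpos : 0 < k * (n + 1) + r := by positivity
      rw [raney_succ_succ, ← add_assoc, Nat.choose_succ_succ']
      generalize hN : k * (n + 1) + r = N at *
      apply Nat.eq_of_mul_eq_mul_left hpos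
      zify [hle] at *
      linear_combination (N + 1 : ℤ) * ihr + (N + 1 : ℤ) * hrec - (k : ℤ) * hchoose +
        ((N.choose (n + 1) : ℤ) + N.choose n) * hN

theorem FC_eq_raney_one (k n : ℕ) (hk : 1 ≤ k) : FC k n = raney k n 1 := by
  have hle : n ≤ k * n := Nat.le_mul_of_pos_left n hk
  have hsub : k * n + 1 - n = (k - 1) * n + 1 := by
    rw [Nat.sub_mul, one_mul]
    omega
  refine Nat.div_eq_of_eq_mul_right (Nat.succ_pos _) ?_
  have hraney := add_mul_raney k n 1 hk
  have hchoose := Nat.choose_mul_succ_eq (k * n) n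
  rw [hsub] at hchoose
  apply Nat.eq_of_mul_eq_mul_left (Nat.succ_pos (k * n))
  simp only [Nat.succ_eq_add_one]
  linear_combination hchoose - ((k - 1) * n + 1) * hraney

/-- For every `k ≥ 1` and `n ≥ 0`, the Fuss–Catalan numbers satisfy
`FC(k, n+1) = Σ_{ℓ₁+⋯+ℓ_k = n} ∏ᵢ FC(k, ℓᵢ)`, the sum ranging over all
`k`-tuples of nonnegative integers summing to `n`. -/
theorem fussCatalan_succ (k n : ℕ) (hk : 1 ≤ k) :
    FC k (n + 1) = ∑ ℓ ∈ Finset.Nat.antidiagonalTuple k n, ∏ i, FC k (ℓ i) := by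
  simp only [FC_eq_raney_one k _ hk, sum_antidiagonalTuple_prod_raney_one]
  rw [← zero_add 1, raney_succ_succ, raney_succ_zero, zero_add, zero_add]
end

section
/- For every k ≥ 1 and every n ≥ 0, the integer (k-1)·n + 1 divides the binomial coefficient C(k·n, n); in particular the Fuss–Catalan number FC(k,n) = (1/((k-1)·n+1)) · C(k·n, n) is a nonnegative integer. -/
/-- If `n ∣ m` then `m + 1` divides the binomial coefficient `C(m + n, n)`. -/
theorem succ_dvd_choose_add_of_dvd {m n : ℕ} (h : n ∣ m) : m + 1 ∣ (m + n).choose n := by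
  have hcop : (m + 1).Coprime n := by
    obtain ⟨c, rfl⟩ := h
    simp
  refine hcop.dvd_of_dvd_mul_right ⟨(m + n).choose (m + 1), ?_⟩
  have hsucc := Nat.choose_succ_right_eq (m + n) m
  rw [Nat.choose_symm_add, Nat.add_sub_cancel_left] at hsucc
  rw [← hsucc, mul_comm]

/-- For every `k ≥ 1` and `n ≥ 0`, the integer `(k-1)·n + 1` divides the binomial
coefficient `C(kn, n)`; in particular the division defining the Fuss–Catalan number
`FC(k,n)` is exact, i.e. `((k-1)·n + 1) · FC(k,n) = C(kn, n)`, so `FC(k,n)` is a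
(nonnegative) integer. -/
theorem fussCatalan_div_exact (k n : ℕ) (hk : 1 ≤ k) :
    ((k - 1) * n + 1) ∣ (k * n).choose n ∧
      ((k - 1) * n + 1) * FC k n = (k * n).choose n := by
  have hmul : k * n = (k - 1) * n + n := by
    rw [← Nat.succ_mul, Nat.succ_eq_add_one, Nat.sub_add_cancel hk]
  have hdvd : (k - 1) * n + 1 ∣ (k * n).choose n := by
    rw [hmul]
    exact succ_dvd_choose_add_of_dvd (dvd_mul_left n (k - 1))
  exact ⟨hdvd, Nat.mul_div_cancel' hdvd⟩
end

section
/- Fix k ≥ 1. If a : ℕ → ℕ is any sequence satisfying a(0) = 1 and, for all n ≥ 0, a(n+1) = Σ_{ℓ : Fin k → ℕ, ℓ₁+⋯+ℓ_k = n} ∏_{i=1}^{k} a(ℓ_i) (the sum being over all k-tuples of nonnegative integers summing to n), then a(n) = FC(k,n) for all n ≥ 0. -/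
/-- The coefficients of a power of a power series, as sums over tuples. -/
theorem PowerSeries.coeff_pow_eq_sum_antidiagonalTuple {R : Type*} [CommSemiring R]
    (f : PowerSeries R) (k n : ℕ) :
    coeff n (f ^ k) = ∑ ℓ ∈ Finset.Nat.antidiagonalTuple k n, ∏ i, coeff (ℓ i) f := by
  have h : f ^ k = ∏ _i : Fin k, f := by simp
  rw [h, coeff_prod]
  refine Finset.sum_equiv Finsupp.equivFunOnFinite (fun ℓ => ?_) (fun ℓ _ => rfl)
  simp [Finset.mem_finsuppAntidiag, Finset.Nat.mem_antidiagonalTuple]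

/-- The Pascal-type recursion satisfied by the numbers `r / (k n + r) * C(k n + r, n)`,
with denominators cleared. -/
theorem raney_step {k n r c d : ℕ} (hk : 1 ≤ k)
    (hc : c * (k * (n + 1) + r) = r * (k * (n + 1) + r).choose (n + 1))
    (hd : d * (k * n + (r + k)) = (r + k) * (k * n + (r + k)).choose n) :
    (c + d) * (k * (n + 1) + (r + 1)) = (r + 1) * (k * (n + 1) + (r + 1)).choose (n + 1) := by
  have hN : k * n + (r + k) = k * (n + 1) + r := by ring
  have hle : n ≤ k * (n + 1) + r := by nlinarith
  have hpos : 0 < k * (n + 1) + r := by positivity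
  have hsucc := Nat.choose_succ_right_eq (k * (n + 1) + r) n
  rw [hN] at hd
  rw [← add_assoc, Nat.choose_succ_succ]
  refine Nat.eq_of_mul_eq_mul_right hpos ?_
  generalize hM : k * (n + 1) + r = N at *
  zify [hle] at *
  linear_combination (N + 1 : ℤ) * hc + (N + 1 : ℤ) * hd - (k : ℤ) * hsucc
    + ((N.choose (n + 1) : ℤ) + N.choose n) * hM

/-- The coefficients of the powers of a series `f` with `f = 1 + X f ^ k` are the
Raney numbers `r / (k n + r) * C(k n + r, n)`. -/
theorem coeff_pow_mul_of_eq_one_add_X_mul_pow {k : ℕ} (hk : 1 ≤ k) {f : PowerSeries ℕ}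
    (hf : f = 1 + PowerSeries.X * f ^ k) (n r : ℕ) :
    PowerSeries.coeff n (f ^ r) * (k * n + r) = r * (k * n + r).choose n := by
  induction n generalizing r with
  | zero =>
    have h : PowerSeries.constantCoeff f = 1 := by rw [hf]; simp
    simp [h]
  | succ n ihn =>
    induction r with
    | zero => simp [PowerSeries.coeff_one]
    | succ r ihr =>
      have h : f ^ (r + 1) = f ^ r + PowerSeries.X * f ^ (r + k) := by
        calc f ^ (r + 1) = f ^ r * f := pow_succ f r
          _ = f ^ r * (1 + PowerSeries.X * f ^ k) := by rw [← hf]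
          _ = f ^ r + PowerSeries.X * f ^ (r + k) := by ring
      rw [h, map_add, PowerSeries.coeff_succ_X_mul]
      exact raney_step hk ihr (ihn (r + k))

/-- Fix `k ≥ 1`. Any sequence `a : ℕ → ℕ` with `a 0 = 1` satisfying the Fuss–Catalan
recursion `a(n+1) = Σ_{ℓ₁+⋯+ℓ_k = n} ∏ᵢ a(ℓᵢ)` (sum over all `k`-tuples of nonnegative
integers summing to `n`) coincides with `FC(k,·)`. -/
theorem eq_fussCatalan_of_recursion (k : ℕ) (hk : 1 ≤ k) (a : ℕ → ℕ)
    (h0 : a 0 = 1)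
    (hrec : ∀ n, a (n + 1) = ∑ ℓ ∈ Finset.Nat.antidiagonalTuple k n, ∏ i, a (ℓ i)) :
    ∀ n, a n = FC k n := by
  intro n
  set f : PowerSeries ℕ := PowerSeries.mk a with hf
  have hfeq : f = 1 + PowerSeries.X * f ^ k := by
    ext m
    cases m with
    | zero => simp [hf, h0]
    | succ m =>
      rw [map_add, PowerSeries.coeff_succ_X_mul,
        PowerSeries.coeff_pow_eq_sum_antidiagonalTuple]
      simp [hf, PowerSeries.coeff_one, hrec]
  have h := coeff_pow_mul_of_eq_one_add_X_mul_pow hk hfeq n 1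
  rw [pow_one, hf, PowerSeries.coeff_mk, one_mul] at h
  have hsub : k * n + 1 - n = (k - 1) * n + 1 := by
    obtain ⟨m, rfl⟩ := Nat.exists_eq_add_of_le' hk
    rw [Nat.add_sub_cancel, Nat.add_mul]
    lia
  have hchoose := Nat.choose_mul_succ_eq (k * n) n
  rw [hsub, ← h] at hchoose
  have hmul : (k * n).choose n = a n * ((k - 1) * n + 1) :=
    Nat.eq_of_mul_eq_mul_right (Nat.succ_pos (k * n)) (by
      rw [Nat.succ_eq_add_one, hchoose]; ring)
  rw [FC, hmul, Nat.mul_div_cancel _ (Nat.succ_pos _)]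
end

section
/- For every n ≥ 1, the number of noncrossing trees on n linearly ordered vertices equals FC(3, n-1) = (1/(2n-1)) · C(3n-3, n-1). (This is the count of rooted planar/linear n-trees: isotopy classes of planar trees with all n vertices on the x-axis.) -/
/-- A graph on the linearly ordered vertex set `Fin n` is noncrossing if there are no two
edges `{a,b}` and `{c,d}` with `a < c < b < d`. -/
def SimpleGraph.Noncrossing {n : ℕ} (G : SimpleGraph (Fin n)) : Prop :=
  ∀ a b c d : Fin n, G.Adj a b → G.Adj c d → ¬(a < c ∧ c < b ∧ b < d)

open PowerSeries in
/-- The power series solution of `T = 1 + X T ^ 3` satisfies a linear differential equation. -/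
theorem PowerSeries.derivative_eq_of_eq_one_add_X_mul_cube {T : ℚ⟦X⟧} (hT : T = 1 + X * T ^ 3) :
    X * (4 * d⁄dX ℚ (d⁄dX ℚ T)) + 6 * d⁄dX ℚ T =
      X * (X * (27 * d⁄dX ℚ (d⁄dX ℚ T)) + 54 * d⁄dX ℚ T) + 6 * T := by
  have hd : ∀ f g : ℚ⟦X⟧, d⁄dX ℚ (f * g) = f * d⁄dX ℚ g + g * d⁄dX ℚ f :=
    fun f g ↦ by simp [Derivation.leibniz]
  have h1 : d⁄dX ℚ T = T ^ 3 + 3 * X * T ^ 2 * d⁄dX ℚ T := by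
    have h := congrArg (d⁄dX ℚ) hT
    simp only [pow_succ, pow_zero, one_mul, map_add, hd, derivative_X, derivative_one] at h
    linear_combination h
  have h2 : d⁄dX ℚ (d⁄dX ℚ T) = 6 * T ^ 2 * d⁄dX ℚ T + 6 * X * T * (d⁄dX ℚ T) ^ 2
      + 3 * X * T ^ 2 * d⁄dX ℚ (d⁄dX ℚ T) := by
    have h := congrArg (d⁄dX ℚ) h1
    have h3 : d⁄dX ℚ (3 : ℚ⟦X⟧) = 0 := (d⁄dX ℚ).map_natCast 3
    simp only [pow_succ, pow_zero, one_mul, map_add, hd, derivative_X, h3] at h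
    linear_combination h
  have hu0 : 3 - 2 * T ≠ 0 := by
    intro h
    have hc := congrArg constantCoeff hT
    have hc' := congrArg constantCoeff h
    simp at hc
    have h2 : constantCoeff (2 : ℚ⟦X⟧) = 2 := map_ofNat constantCoeff 2
    have h3 : constantCoeff (3 : ℚ⟦X⟧) = 3 := map_ofNat constantCoeff 3
    norm_num [hc, h2, h3] at hc'
  set D := d⁄dX ℚ T
  set E := d⁄dX ℚ D
  have e1 : (3 - 2 * T) * D = T ^ 4 := by
    linear_combination T * h1 - 3 * D * hT
  have e2 : (3 - 2 * T) ^ 3 * E = 6 * T ^ 7 * (3 - 2 * T) + 6 * X * T ^ 10 := by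
    linear_combination (3 - 2 * T) ^ 2 * T * h2 - 3 * (3 - 2 * T) ^ 2 * E * hT +
      (6 * T ^ 3 * (3 - 2 * T) + 6 * X * T ^ 2 * ((3 - 2 * T) * D + T ^ 4)) * e1
  apply mul_left_cancel₀ (pow_ne_zero 3 hu0)
  have hP : X * T ^ 3 = T - 1 := by linear_combination -hT
  set u := 3 - 2 * T
  linear_combination (4 * X - 27 * X ^ 2) * e2 + (6 - 54 * X) * u ^ 2 * e1 +
    (24 * T ^ 4 * u - 54 * T * u ^ 2 + (24 * T ^ 4 - 162 * T * u) * (X * T ^ 3 + T - 1)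
      - 162 * T * ((X * T ^ 3) ^ 2 + X * T ^ 3 * (T - 1) + (T - 1) ^ 2)) * hP

open Finset in
/-- The ternary Catalan recurrence determines the Fuss–Catalan numbers `FC(3, n)`. -/
theorem two_mul_add_one_mul_eq_choose_of_recurrence {t : ℕ → ℕ} (h0 : t 0 = 1)
    (hs : ∀ n, t (n + 1) = ∑ p ∈ antidiagonal n, t p.1 * ∑ q ∈ antidiagonal p.2, t q.1 * t q.2)
    (n : ℕ) : (2 * n + 1) * t n = (3 * n).choose n := by
  have hT : PowerSeries.mk (fun n ↦ (t n : ℚ)) =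
      1 + PowerSeries.X * PowerSeries.mk (fun n ↦ (t n : ℚ)) ^ 3 := by
    ext n
    cases n with
    | zero => simp [h0]
    | succ n =>
      rw [map_add, PowerSeries.coeff_succ_X_mul]
      simp [pow_succ', PowerSeries.coeff_mul, hs, PowerSeries.coeff_one]
  have hrec : ∀ n : ℕ, 2 * (n + 1) * (2 * n + 3) * t (n + 1) =
      3 * (3 * n + 1) * (3 * n + 2) * t n := by
    intro n
    have h := congrArg (PowerSeries.coeff n)
      (PowerSeries.derivative_eq_of_eq_one_add_X_mul_cube hT)
    have hc : ∀ (k m : ℕ) [k.AtLeastTwo] (f : PowerSeries ℚ), PowerSeries.coeff m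
        ((OfNat.ofNat k : PowerSeries ℚ) * f) = (OfNat.ofNat k : ℚ) * PowerSeries.coeff m f := by
      intro k m _ f
      rw [← PowerSeries.coeff_C_mul, map_ofNat]
    have hc0 : ∀ (k : ℕ) [k.AtLeastTwo],
        PowerSeries.constantCoeff (OfNat.ofNat k : PowerSeries ℚ) = OfNat.ofNat k :=
      fun k _ ↦ map_ofNat _ k
    have hd0 : ∀ f : PowerSeries ℚ,
        PowerSeries.constantCoeff (PowerSeries.derivative ℚ f) = PowerSeries.coeff 1 f := by
      intro f
      simpa using PowerSeries.coeff_derivative f 0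
    have : (2 * (n + 1) * (2 * n + 3) * t (n + 1) : ℚ) =
      3 * (3 * n + 1) * (3 * n + 2) * t n := by
      rcases n with _ | _ | n <;>
        simp [hc, hc0, hd0, PowerSeries.coeff_succ_X_mul, PowerSeries.coeff_derivative] at h
      · norm_num [h]
      · push_cast; linarith
      · push_cast; linarith
    exact_mod_cast this
  induction n with
  | zero => simp [h0]
  | succ n ih =>
    have a1 := Nat.add_one_mul_choose_eq (3 * n) n
    have a2 := Nat.choose_mul_succ_eq (3 * n + 1) (n + 1)
    have a3 := Nat.choose_mul_succ_eq (3 * n + 2) (n + 1)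
    have : 3 * n + 1 + 1 - (n + 1) = 2 * n + 1 := by omega
    rw [this] at a2
    have : 3 * n + 2 + 1 - (n + 1) = 2 * n + 2 := by omega
    rw [this] at a3
    rw [show 3 * (n + 1) = 3 * n + 2 + 1 by ring]
    have hn := hrec n
    have : (n + 1) * (2 * n + 1) * (2 * n + 2) * ((2 * (n + 1) + 1) * t (n + 1)) =
        (n + 1) * (2 * n + 1) * (2 * n + 2) * (3 * n + 2 + 1).choose (n + 1) := by
      zify at *
      linear_combination (2 * n + 1) * (n + 1) * hn +
        3 * (3 * n + 1) * (3 * n + 2) * (n + 1) * ih +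
        (3 * n + 2) * (3 * n + 3) * a1 + (3 * n + 3) * (n + 1) * a2 + (n + 1) * (2 * n + 1) * a3
    exact Nat.eq_of_mul_eq_mul_left (by positivity) this

namespace SimpleGraph

theorem Reachable.of_forall_adj {V W : Type*} {G : SimpleGraph V} {H : SimpleGraph W} (f : V → W)
    (hf : ∀ x y, G.Adj x y → H.Reachable (f x) (f y)) {u v : V} (h : G.Reachable u v) :
    H.Reachable (f u) (f v) := by
  obtain ⟨w⟩ := h
  induction w with
  | nil => rfl
  | cons hadj _ ih => exact (hf _ _ hadj).trans ih

theorem Reachable.exists_adj_boundary {V : Type*} {G : SimpleGraph V} {u v : V}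
    (h : G.Reachable u v) (P : V → Prop) (hu : P u) (hv : ¬ P v) :
    ∃ x y, G.Adj x y ∧ P x ∧ ¬ P y := by
  obtain ⟨w⟩ := h
  obtain ⟨d, -, h1, h2⟩ := w.exists_boundary_dart {x | P x} hu hv
  exact ⟨d.fst, d.snd, d.adj, h1, h2⟩

theorem IsBridge.of_map {V W : Type*} {G : SimpleGraph V} {K : SimpleGraph W} (f : V → W) {x y : V}
    (hf : ∀ u v, G.Adj u v → s(u, v) ≠ s(x, y) →
      f u = f v ∨ K.Adj (f u) (f v) ∧ s(f u, f v) ≠ s(f x, f y))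
    (hb : K.IsBridge s(f x, f y)) : G.IsBridge s(x, y) := by
  rw [isBridge_iff] at hb ⊢
  refine fun h ↦ hb (h.of_forall_adj f fun u v huv ↦ ?_)
  rw [deleteEdges_adj] at huv
  rcases hf u v huv.1 huv.2 with h | h
  · rw [h]
  · exact Adj.reachable (deleteEdges_adj.2 h)

/-- A noncrossing tree on the vertices `a, …, b`, viewed as a graph on `ℕ` in which all other
vertices are isolated. -/
structure IsNCTree (a b : ℕ) (G : SimpleGraph ℕ) : Prop where
  mem_Icc : ∀ {x y}, G.Adj x y → a ≤ x ∧ x ≤ b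
  reachable : ∀ {x}, a ≤ x → x ≤ b → G.Reachable a x
  isAcyclic : G.IsAcyclic
  noncrossing : ∀ {x y z w}, G.Adj x y → G.Adj z w → x < z → z < y → ¬ y < w

theorem IsNCTree.isBridge {a b : ℕ} {G : SimpleGraph ℕ} (hG : IsNCTree a b G) {x y : ℕ}
    (h : G.Adj x y) : G.IsBridge s(x, y) :=
  isAcyclic_iff_forall_adj_isBridge.1 hG.isAcyclic h

/-- Join noncrossing trees on `0, …, i`, on `i + 1, …, j` and on `j, …, b` by the edge `0 j`. -/
def ncJoin (j : ℕ) (G₁ G₂ G₃ : SimpleGraph ℕ) : SimpleGraph ℕ :=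
  G₁ ⊔ G₂ ⊔ G₃ ⊔ edge 0 j

theorem ncJoin_adj {j : ℕ} {G₁ G₂ G₃ : SimpleGraph ℕ} {x y : ℕ} :
    (ncJoin j G₁ G₂ G₃).Adj x y ↔ G₁.Adj x y ∨ G₂.Adj x y ∨ G₃.Adj x y ∨
      (x = 0 ∧ y = j ∨ x = j ∧ y = 0) ∧ x ≠ y := by
  simp only [ncJoin, sup_adj, edge_adj]
  grind

section Join

variable {i j b : ℕ} {G₁ G₂ G₃ : SimpleGraph ℕ}

theorem isAcyclic_ncJoin (hij : i < j) (h₁ : IsNCTree 0 i G₁)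
    (h₂ : IsNCTree (i + 1) j G₂) (h₃ : IsNCTree j b G₃) : (ncJoin j G₁ G₂ G₃).IsAcyclic := by
  rw [isAcyclic_iff_forall_adj_isBridge]
  intro x y hxy
  have b₁ : ∀ {u v}, G₁.Adj u v → u ≤ i ∧ v ≤ i :=
    fun h ↦ ⟨(h₁.mem_Icc h).2, (h₁.mem_Icc h.symm).2⟩
  have b₂ : ∀ {u v}, G₂.Adj u v → (i < u ∧ u ≤ j) ∧ i < v ∧ v ≤ j :=
    fun h ↦ ⟨h₂.mem_Icc h, h₂.mem_Icc h.symm⟩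
  have b₃ : ∀ {u v}, G₃.Adj u v → j ≤ u ∧ j ≤ v :=
    fun h ↦ ⟨(h₃.mem_Icc h).1, (h₃.mem_Icc h.symm).1⟩
  rcases ncJoin_adj.1 hxy with h | h | h | h
  · have hb := h₁.isBridge h
    obtain ⟨hx, hy⟩ := b₁ h
    refine IsBridge.of_map (K := G₁) (fun v ↦ if v ≤ i then v else 0) ?_ (by simpa [hx, hy])
    intro u v huv hne
    simp only [hx, hy, if_true]
    rcases ncJoin_adj.1 huv with h | h | h | h
    · obtain ⟨hu, hv⟩ := b₁ h
      simp [hu, hv, h, hne]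
    · have := b₂ h
      left; split_ifs <;> omega
    · have := b₃ h
      left; split_ifs <;> omega
    · left; split_ifs <;> omega
  · have hb := h₂.isBridge h
    obtain ⟨hx, hy⟩ := b₂ h
    have key : ∀ v, i < v → v ≤ j → (if v ≤ i then j else min v j) = v := by grind
    refine IsBridge.of_map (K := G₂) (fun v ↦ if v ≤ i then j else min v j) ?_
      (by simpa only [key x hx.1 hx.2, key y hy.1 hy.2])
    intro u v huv hne
    simp only [key x hx.1 hx.2, key y hy.1 hy.2]
    rcases ncJoin_adj.1 huv with h | h | h | h
    · have := b₁ h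
      left; split_ifs <;> omega
    · obtain ⟨hu, hv⟩ := b₂ h
      rw [key u hu.1 hu.2, key v hv.1 hv.2]
      exact .inr ⟨h, hne⟩
    · have := b₃ h
      left; split_ifs <;> omega
    · left; split_ifs <;> omega
  · have hb := h₃.isBridge h
    obtain ⟨hx, hy⟩ := b₃ h
    refine IsBridge.of_map (K := G₃) (fun v ↦ max v j) ?_ (by simpa [hx, hy])
    intro u v huv hne
    simp only [hx, hy, sup_of_le_left]
    rcases ncJoin_adj.1 huv with h | h | h | h
    · have := b₁ h
      left; omega
    · have := b₂ h
      left; omega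
    · obtain ⟨hu, hv⟩ := b₃ h
      simp [hu, hv, h, hne]
    · left; omega
  · refine IsBridge.of_map (K := (⊥ : SimpleGraph Prop)) (fun v ↦ v ≤ i) ?_ ?_
    · intro u v huv hne
      left
      rcases ncJoin_adj.1 huv with h | h | h | h
      · have := b₁ h
        simp; omega
      · have := b₂ h
        simp; omega
      · have := b₃ h
        simp; omega
      · grind
    · apply IsBridge.of_not_reachable
      simp only [reachable_bot, eq_iff_iff]
      omega

theorem isNCTree_ncJoin (hij : i < j) (hjb : j ≤ b) (h₁ : IsNCTree 0 i G₁)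
    (h₂ : IsNCTree (i + 1) j G₂) (h₃ : IsNCTree j b G₃) :
    IsNCTree 0 b (ncJoin j G₁ G₂ G₃) where
  mem_Icc {x y} h := by
    rcases ncJoin_adj.1 h with h | h | h | h
    · have := h₁.mem_Icc h; omega
    · have := h₂.mem_Icc h; omega
    · have := h₃.mem_Icc h; omega
    · omega
  reachable {x} _ hx := by
    have l₁ : G₁ ≤ ncJoin j G₁ G₂ G₃ := fun _ _ h ↦ ncJoin_adj.2 (by tauto)
    have l₂ : G₂ ≤ ncJoin j G₁ G₂ G₃ := fun _ _ h ↦ ncJoin_adj.2 (by tauto)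
    have l₃ : G₃ ≤ ncJoin j G₁ G₂ G₃ := fun _ _ h ↦ ncJoin_adj.2 (by tauto)
    have h0j : (ncJoin j G₁ G₂ G₃).Reachable 0 j :=
      Adj.reachable (ncJoin_adj.2 (by right; right; right; omega))
    rcases le_or_gt x i with hi | hi
    · exact (h₁.reachable (Nat.zero_le _) hi).mono l₁
    rcases le_or_gt x j with hj | hj
    · exact h0j.trans (((h₂.reachable hij le_rfl).symm.trans (h₂.reachable hi hj)).mono l₂)
    · exact h0j.trans ((h₃.reachable hj.le hx).mono l₃)
  isAcyclic := isAcyclic_ncJoin hij h₁ h₂ h₃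
  noncrossing {x y z w} hxy hzw h1 h2 h3 := by
    rcases ncJoin_adj.1 hxy with h | h | h | h <;> rcases ncJoin_adj.1 hzw with h' | h' | h' | h'
    · exact h₁.noncrossing h h' h1 h2 h3
    all_goals first
      | exact h₂.noncrossing h h' h1 h2 h3
      | exact h₃.noncrossing h h' h1 h2 h3
      | skip
    all_goals
      have a1 := @h₁.mem_Icc
      have a2 := @h₂.mem_Icc
      have a3 := @h₃.mem_Icc
      grind [SimpleGraph.Adj.symm]

end Join

/-- In a noncrossing graph, two connected components cannot interleave. -/
theorem Reachable.of_crossing {G : SimpleGraph ℕ}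
    (hG : ∀ {x y z w}, G.Adj x y → G.Adj z w → x < z → z < y → ¬ y < w) {p q r s : ℕ}
    (hpq : p < q) (hqr : q < r) (hrs : r < s) (hpr : G.Reachable p r) (hqs : G.Reachable q s) :
    G.Reachable p q := by
  by_contra hn
  obtain ⟨a, c, hac, ⟨hpa, ha⟩, hc⟩ := hpr.exists_adj_boundary
    (fun v ↦ G.Reachable p v ∧ (v < q ∨ s < v)) ⟨.rfl, .inl hpq⟩ (by omega)
  have hpc : G.Reachable p c := hpa.trans hac.reachable
  have hnq : ∀ {v}, G.Reachable p v → ¬ G.Reachable q v := fun h h' ↦ hn (h.trans h'.symm)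
  have hcq : c ≠ q := by rintro rfl; exact hn hpc
  have hcs : c ≠ s := by rintro rfl; exact hnq hpc hqs
  have hc' : q < c ∧ c < s := by
    have : ¬ (c < q ∨ s < c) := fun h ↦ hc ⟨hpc, h⟩
    omega
  obtain ⟨u, v, huv, ⟨hqu, hu⟩, hv⟩ := hqs.exists_adj_boundary
    (fun v ↦ G.Reachable q v ∧ ((a < v ∧ v < c) ∨ (v < c ∧ c < a) ∨ (c < a ∧ a < v)))
    ⟨.rfl, by omega⟩ (by omega)
  have hqv : G.Reachable q v := hqu.trans huv.reachable
  have hv' : ¬ ((a < v ∧ v < c) ∨ (v < c ∧ c < a) ∨ (c < a ∧ a < v)) := fun h ↦ hv ⟨hqv, h⟩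
  have e1 : u ≠ a := by rintro rfl; exact hnq hpa hqu
  have e2 : u ≠ c := by rintro rfl; exact hnq hpc hqu
  have e3 : v ≠ a := by rintro rfl; exact hnq hpa hqv
  have e4 : v ≠ c := by rintro rfl; exact hnq hpc hqv
  have t1 := @hG
  have := hac.symm
  have := huv.symm
  grind

/-- The edges of `G` with both ends in `a, …, b`. -/
def restrictIcc (a b : ℕ) (G : SimpleGraph ℕ) : SimpleGraph ℕ where
  Adj x y := G.Adj x y ∧ (a ≤ x ∧ x ≤ b) ∧ a ≤ y ∧ y ≤ b
  symm := ⟨fun _ _ h ↦ ⟨h.1.symm, h.2.2, h.2.1⟩⟩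
  loopless := ⟨fun _ h ↦ h.1.ne rfl⟩

theorem restrictIcc_adj {a b : ℕ} {G : SimpleGraph ℕ} {x y : ℕ} :
    (restrictIcc a b G).Adj x y ↔ G.Adj x y ∧ (a ≤ x ∧ x ≤ b) ∧ a ≤ y ∧ y ≤ b := Iff.rfl

theorem IsNCTree.restrictIcc {a b c d : ℕ} {G : SimpleGraph ℕ} (hG : IsNCTree a b G)
    (hr : ∀ x, c ≤ x → x ≤ d → (restrictIcc c d G).Reachable c x) :
    IsNCTree c d (restrictIcc c d G) where
  mem_Icc h := h.2.1
  reachable {x} := hr x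
  isAcyclic := hG.isAcyclic.anti fun _ _ h ↦ h.1
  noncrossing h h' := hG.noncrossing h.1 h'.1

theorem _root_.Nat.exists_greatest {P : ℕ → Prop} {b : ℕ} (hb : ∀ k, P k → k ≤ b) (h : ∃ k, P k) :
    ∃ m, P m ∧ ∀ k, P k → k ≤ m := by
  have hbdd : BddAbove {k | P k} := ⟨b, hb⟩
  exact ⟨sSup {k | P k}, Nat.sSup_mem h hbdd, fun k hk ↦ le_csSup hbdd hk⟩

/-- Removing the longest edge at `0` splits a noncrossing tree into three. -/
theorem IsNCTree.exists_eq_ncJoin {b : ℕ} (hb : 0 < b) {G : SimpleGraph ℕ} (hG : IsNCTree 0 b G) :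
    ∃ i j G₁ G₂ G₃, i < j ∧ j ≤ b ∧ IsNCTree 0 i G₁ ∧ IsNCTree (i + 1) j G₂ ∧ IsNCTree j b G₃ ∧
      ncJoin j G₁ G₂ G₃ = G := by
  have hle : ∀ {x y}, G.Adj x y → x ≤ b := fun h ↦ (hG.mem_Icc h).2
  obtain ⟨j, h0j, hjmax⟩ : ∃ j, G.Adj 0 j ∧ ∀ k, G.Adj 0 k → k ≤ j := by
    apply Nat.exists_greatest fun k hk ↦ hle hk.symm
    obtain ⟨x, y, hxy, rfl, -⟩ := (hG.reachable hb.le le_rfl).exists_adj_boundary (· = 0) rfl hb.ne'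
    exact ⟨y, hxy⟩
  have hj0 : 0 < j := Nat.pos_of_ne_zero h0j.ne'
  have hjb : j ≤ b := hle h0j.symm
  have hover : ∀ {x y}, G.Adj x y → x < j → ¬ j < y := by
    intro x y hxy hx hy
    rcases Nat.eq_zero_or_pos x with rfl | h0
    · exact absurd (hjmax y hxy) (by omega)
    · exact hG.noncrossing h0j hxy h0 hx hy
  set K := G.deleteEdges {s(0, j)} with hK
  have hKadj : ∀ {x y}, K.Adj x y ↔ G.Adj x y ∧ s(x, y) ≠ s(0, j) := by simp [hK]
  have hbr : ¬ K.Reachable 0 j := isBridge_iff.1 (hG.isBridge h0j)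
  have hcov : ∀ v ≤ b, K.Reachable 0 v ∨ K.Reachable j v := by
    intro v hv
    by_contra hn
    obtain ⟨x, y, hxy, hx, hy⟩ := (hG.reachable (Nat.zero_le v) hv).exists_adj_boundary
      (fun v ↦ K.Reachable 0 v ∨ K.Reachable j v) (.inl .rfl) hn
    by_cases he : s(x, y) = s(0, j)
    · rcases Sym2.eq_iff.1 he with ⟨-, rfl⟩ | ⟨-, rfl⟩
      · exact hy (.inr .rfl)
      · exact hy (.inl .rfl)
    · have := (hKadj.2 ⟨hxy, he⟩).reachable
      exact hy (hx.imp (·.trans this) (·.trans this))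
  have hlt : ∀ v, K.Reachable 0 v → v < j := by
    intro v hv
    by_contra hn
    obtain ⟨x, y, hxy, ⟨hx, hxj⟩, hy⟩ := hv.exists_adj_boundary
      (fun v ↦ K.Reachable 0 v ∧ v < j) ⟨.rfl, hj0⟩ (by tauto)
    have h0y := hx.trans hxy.reachable
    have hjy : j ≤ y := not_lt.1 fun h ↦ hy ⟨h0y, h⟩
    rcases hjy.eq_or_lt with rfl | hjy
    · exact hbr h0y
    · exact hover (hKadj.1 hxy).1 hxj hjy
  obtain ⟨i, h0i, himax⟩ : ∃ i, K.Reachable 0 i ∧ ∀ k, K.Reachable 0 k → k ≤ i :=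
    Nat.exists_greatest (fun k hk ↦ (hlt k hk).le) ⟨0, .rfl⟩
  have hij := hlt i h0i
  have hreach : ∀ v, K.Reachable 0 v ↔ v ≤ i := by
    refine fun v ↦ ⟨himax v, fun hv ↦ ?_⟩
    rcases Nat.eq_zero_or_pos v with rfl | h0
    · rfl
    rcases hv.eq_or_lt with rfl | hv
    · exact h0i
    rcases hcov v (by omega) with h | h
    · exact h
    · exact Reachable.of_crossing
        (fun h h' ↦ hG.noncrossing (hKadj.1 h).1 (hKadj.1 h').1) h0 hv hij h0i h.symm
  have hside : ∀ {x y}, K.Adj x y → (x ≤ i ↔ y ≤ i) := by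
    intro x y hxy
    rw [← hreach, ← hreach]
    exact ⟨(·.trans hxy.reachable), (·.trans hxy.symm.reachable)⟩
  have hjreach : ∀ v, i < v → v ≤ b → K.Reachable j v := by
    intro v hv hvb
    exact (hcov v hvb).resolve_left (by rw [hreach]; omega)
  refine ⟨i, j, G.restrictIcc 0 i, G.restrictIcc (i + 1) j, G.restrictIcc j b, hij, hjb,
    hG.restrictIcc ?_, hG.restrictIcc ?_, hG.restrictIcc ?_, ?_⟩
  · intro v _ hv
    have := ((hreach v).2 hv).of_forall_adj (H := G.restrictIcc 0 i)
      (fun v ↦ if v ≤ i then v else 0) ?_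
    · simpa [hv] using this
    intro x y hxy
    have := hside hxy
    by_cases hx : x ≤ i
    · have hy := this.1 hx
      simp only [hx, hy, if_true]
      exact Adj.reachable ⟨(hKadj.1 hxy).1, by omega⟩
    · have hy : ¬ y ≤ i := hx ∘ this.2
      simp [hx, hy]
  · have key : ∀ v, i < v → v ≤ j → (G.restrictIcc (i + 1) j).Reachable j v := by
      intro v hv hvj
      have := (hjreach v hv (by omega)).of_forall_adj (H := G.restrictIcc (i + 1) j)
        (fun v ↦ if v ≤ i then j else min v j) ?_
      · simpa [hv.not_ge, hij.not_ge, hvj] using this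
      intro x y hxy
      have := hside hxy
      by_cases hx : x ≤ i
      · have hy := this.1 hx
        simp [hx, hy]
      · have hy : ¬ y ≤ i := hx ∘ this.2
        simp only [hx, hy, if_false]
        have h1 := hover (hKadj.1 hxy).1
        have h2 := hover (hKadj.1 hxy).1.symm
        by_cases hx' : x < j
        · have : y ≤ j := by have := h1 hx'; omega
          rw [min_eq_left hx'.le, min_eq_left this]
          exact Adj.reachable ⟨(hKadj.1 hxy).1, by omega⟩
        · by_cases hy' : y < j
          · have : x ≤ j := by have := h2 hy'; omega
            rw [min_eq_left this, min_eq_left hy'.le]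
            exact Adj.reachable ⟨(hKadj.1 hxy).1, by omega⟩
          · rw [min_eq_right (not_lt.1 hx'), min_eq_right (not_lt.1 hy')]
    intro v hv hvj
    exact (key (i + 1) (by omega) hij).symm.trans (key v hv hvj)
  · intro v hv hvb
    have := (hjreach v (by omega) hvb).of_forall_adj (H := G.restrictIcc j b) (max · j) ?_
    · simpa [hv] using this
    intro x y hxy
    have h1 := hover (hKadj.1 hxy).1
    have h2 := hover (hKadj.1 hxy).1.symm
    have h3 := hle (hKadj.1 hxy).1
    have h4 := hle (hKadj.1 hxy).1.symm
    by_cases h : j ≤ x ∧ j ≤ y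
    · rw [max_eq_left h.1, max_eq_left h.2]
      exact Adj.reachable ⟨(hKadj.1 hxy).1, by omega⟩
    · rw [max_eq_right (by omega), max_eq_right (by omega)]
  · ext x y
    simp only [ncJoin_adj, restrictIcc_adj]
    constructor
    · rintro (h | h | h | ⟨⟨rfl, rfl⟩ | ⟨rfl, rfl⟩, -⟩)
      exacts [h.1, h.1, h.1, h0j, h0j.symm]
    · intro h
      by_cases he : s(x, y) = s(0, j)
      · have := Sym2.eq_iff.1 he
        have := h.ne
        tauto
      · have := hside (hKadj.2 ⟨h, he⟩)
        have h1 := hover h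
        have h2 := hover h.symm
        have h3 := hle h
        have h4 := hle h.symm
        simp only [h, true_and]
        omega

theorem ncJoin_injective {b i j i' j' : ℕ} {G₁ G₂ G₃ G₁' G₂' G₃' : SimpleGraph ℕ}
    (hij : i < j) (h₁ : IsNCTree 0 i G₁) (h₂ : IsNCTree (i + 1) j G₂) (h₃ : IsNCTree j b G₃)
    (hij' : i' < j') (h₁' : IsNCTree 0 i' G₁') (h₂' : IsNCTree (i' + 1) j' G₂')
    (h₃' : IsNCTree j' b G₃') (h : ncJoin j G₁ G₂ G₃ = ncJoin j' G₁' G₂' G₃') :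
    i = i' ∧ j = j' ∧ G₁ = G₁' ∧ G₂ = G₂' ∧ G₃ = G₃' := by
  have hadj : ∀ x y, (ncJoin j G₁ G₂ G₃).Adj x y ↔ (ncJoin j' G₁' G₂' G₃').Adj x y := by simp [h]
  simp only [ncJoin_adj] at hadj
  have bounds : ∀ {a b : ℕ} {G : SimpleGraph ℕ}, IsNCTree a b G →
      ∀ x y, G.Adj x y → (a ≤ x ∧ x ≤ b) ∧ a ≤ y ∧ y ≤ b :=
    fun hG x y h ↦ ⟨hG.mem_Icc h, hG.mem_Icc h.symm⟩
  have b₁ := bounds h₁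
  have b₂ := bounds h₂
  have b₃ := bounds h₃
  have b₁' := bounds h₁'
  have b₂' := bounds h₂'
  have b₃' := bounds h₃'
  have hj : j = j' := by
    have e1 := hadj 0 j
    have e2 := hadj 0 j'
    have := b₁ 0 j'
    have := b₂ 0 j'
    have := b₃ 0 j'
    have := b₁' 0 j
    have := b₂' 0 j
    have := b₃' 0 j
    grind
  subst hj
  have hi : ∀ {i i' : ℕ} {G₁ G₂ G₃ G₁' G₂' G₃' : SimpleGraph ℕ}, i < j → i' < j →
      IsNCTree 0 i G₁ → IsNCTree (i + 1) j G₂ → IsNCTree j b G₃ → IsNCTree 0 i' G₁' →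
      ncJoin j G₁ G₂ G₃ = ncJoin j G₁' G₂' G₃' → i' ≤ i := by
    intro i i' G₁ G₂ G₃ G₁' G₂' G₃' hij hij' h₁ h₂ h₃ h₁' h
    by_contra hlt
    obtain ⟨x, y, hxy, hx, hy⟩ := (h₁'.reachable (Nat.zero_le i') le_rfl).exists_adj_boundary
      (· ≤ i) (Nat.zero_le i) hlt
    have hb' := bounds h₁' x y hxy
    have : (ncJoin j G₁ G₂ G₃).Adj x y := by rw [h, ncJoin_adj]; exact .inl hxy
    rcases ncJoin_adj.1 this with h | h | h | h
    · have := bounds h₁ x y h; omega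
    · have := bounds h₂ x y h; omega
    · have := bounds h₃ x y h; omega
    · omega
  have hi : i = i' := le_antisymm (hi hij' hij h₁' h₂' h₃' h₁ h.symm) (hi hij hij' h₁ h₂ h₃ h₁' h)
  subst hi
  refine ⟨rfl, rfl, ?_, ?_, ?_⟩ <;>
  · ext x y
    have := hadj x y
    have := b₁ x y
    have := b₂ x y
    have := b₃ x y
    have := b₁' x y
    have := b₂' x y
    have := b₃' x y
    have n₁ := fun h : G₁.Adj x y ↦ h.ne
    have n₂ := fun h : G₂.Adj x y ↦ h.ne
    have n₃ := fun h : G₃.Adj x y ↦ h.ne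
    have n₁' := fun h : G₁'.Adj x y ↦ h.ne
    have n₂' := fun h : G₂'.Adj x y ↦ h.ne
    have n₃' := fun h : G₃'.Adj x y ↦ h.ne
    grind

/-- The order embedding of `Fin (n + 1)` onto `a, …, a + n`. -/
def finShift (a n : ℕ) : Fin (n + 1) ↪ ℕ where
  toFun x := a + x
  inj' x y h := by simpa [Fin.ext_iff] using h

theorem finShift_apply {a n : ℕ} (x : Fin (n + 1)) : finShift a n x = a + x := rfl

/-- A left inverse of `finShift a n`. -/
def finUnshift (a n x : ℕ) : Fin (n + 1) := ⟨min (x - a) n, by omega⟩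

theorem finUnshift_finShift {a n : ℕ} (x : Fin (n + 1)) :
    finUnshift a n (finShift a n x) = x := by
  simp only [finShift_apply, finUnshift, Fin.ext_iff]
  omega

theorem finShift_finUnshift {a n x : ℕ} (h1 : a ≤ x) (h2 : x ≤ a + n) :
    finShift a n (finUnshift a n x) = x := by
  simp only [finShift_apply, finUnshift]
  omega

theorem IsNCTree.comap_finShift {a n : ℕ} {G : SimpleGraph ℕ} (hG : IsNCTree a (a + n) G) :
    (G.comap (finShift a n)).IsTree ∧ (G.comap (finShift a n)).Noncrossing := by
  have hr : ∀ x, (G.comap (finShift a n)).Reachable (finUnshift a n a) x := by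
    intro x
    rw [← finUnshift_finShift (a := a) x]
    refine Reachable.of_forall_adj (finUnshift a n) (fun u v huv ↦ Adj.reachable ?_)
      (hG.reachable (x := finShift a n x) (Nat.le_add_right _ _) ?_)
    · have hu := hG.mem_Icc huv
      have hv := hG.mem_Icc huv.symm
      rwa [comap_adj, finShift_finUnshift hu.1 hu.2, finShift_finUnshift hv.1 hv.2]
    · simp only [finShift_apply]
      omega
  refine ⟨⟨⟨fun x y ↦ (hr x).symm.trans (hr y)⟩, hG.isAcyclic.of_comap _⟩, ?_⟩
  rintro x y z w h1 h2 ⟨h3, h4, h5⟩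
  rw [comap_adj] at h1 h2
  refine hG.noncrossing h1 h2 ?_ ?_ ?_ <;>
    simpa only [finShift_apply, add_lt_add_iff_left, Fin.val_fin_lt]

theorem IsTree.map_finShift {a n : ℕ} {G : SimpleGraph (Fin (n + 1))} (hG : G.IsTree)
    (hnc : G.Noncrossing) : IsNCTree a (a + n) (G.map (finShift a n)) where
  mem_Icc h := by
    obtain ⟨u, v, -, rfl, -⟩ := (map_adj _ _ _ _).1 h
    simp only [finShift_apply]
    omega
  reachable {x} h1 h2 := by
    have := (hG.connected 0 (finUnshift a n x)).of_forall_adj (H := G.map (finShift a n))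
      (finShift a n) fun u v huv ↦ Adj.reachable ((map_adj _ _ _ _).2 ⟨u, v, huv, rfl, rfl⟩)
    rwa [finShift_finUnshift h1 h2] at this
  isAcyclic := by
    rw [isAcyclic_iff_forall_adj_isBridge]
    intro x y hxy
    obtain ⟨u, v, huv, rfl, rfl⟩ := (map_adj _ _ _ _).1 hxy
    refine IsBridge.of_map (K := G) (finUnshift a n) ?_ ?_
    · intro x y hxy hne
      obtain ⟨u', v', huv', rfl, rfl⟩ := (map_adj _ _ _ _).1 hxy
      simp only [finUnshift_finShift]
      refine .inr ⟨huv', fun h ↦ hne ?_⟩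
      simpa using congrArg (Sym2.map (finShift a n)) h
    · simp only [finUnshift_finShift]
      exact isAcyclic_iff_forall_adj_isBridge.1 hG.isAcyclic huv
  noncrossing {x y z w} h1 h2 h3 h4 h5 := by
    obtain ⟨u, v, huv, rfl, rfl⟩ := (map_adj _ _ _ _).1 h1
    obtain ⟨u', v', huv', rfl, rfl⟩ := (map_adj _ _ _ _).1 h2
    simp only [finShift_apply, add_lt_add_iff_left, Fin.val_fin_lt] at h3 h4 h5
    exact hnc _ _ _ _ huv huv' ⟨h3, h4, h5⟩

/-- Noncrossing trees on `a, …, a + n` are noncrossing trees on `Fin (n + 1)`. -/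
def ncTreeEquiv (a n : ℕ) : {G : SimpleGraph ℕ // IsNCTree a (a + n) G} ≃
    {G : SimpleGraph (Fin (n + 1)) | G.IsTree ∧ G.Noncrossing} where
  toFun G := ⟨G.1.comap (finShift a n), G.2.comap_finShift⟩
  invFun G := ⟨G.1.map (finShift a n), G.2.1.map_finShift G.2.2⟩
  left_inv := by
    rintro ⟨G, hG⟩
    ext x y
    simp only [map_adj, comap_adj]
    constructor
    · rintro ⟨u, v, h, rfl, rfl⟩
      exact h
    · intro h
      have hx := hG.mem_Icc h
      have hy := hG.mem_Icc h.symm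
      refine ⟨finUnshift a n x, finUnshift a n y, ?_, ?_, ?_⟩ <;>
        simp only [finShift_finUnshift hx.1 hx.2, finShift_finUnshift hy.1 hy.2, h]
  right_inv G := Subtype.ext (comap_map_eq _ _)

instance (a n : ℕ) : Finite {G : SimpleGraph ℕ // IsNCTree a (a + n) G} :=
  Finite.of_equiv _ (ncTreeEquiv a n).symm

open Finset in
/-- A noncrossing tree with `n + 1` edges from an edge and three noncrossing trees having
`n` edges in total. -/
def ncJoinOfAntidiagonal (n : ℕ) :
    (Σ p : antidiagonal n, {G : SimpleGraph ℕ // IsNCTree 0 (0 + p.1.1) G} ×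
      Σ q : antidiagonal p.1.2,
        {G : SimpleGraph ℕ // IsNCTree (p.1.1 + 1) (p.1.1 + 1 + q.1.1) G} ×
        {G : SimpleGraph ℕ // IsNCTree (p.1.1 + 1 + q.1.1) (p.1.1 + 1 + q.1.1 + q.1.2) G}) →
      {G : SimpleGraph ℕ // IsNCTree 0 (0 + (n + 1)) G}
  | ⟨⟨⟨i, m⟩, hp⟩, ⟨G₁, h₁⟩, ⟨⟨k, l⟩, hq⟩, ⟨G₂, h₂⟩, ⟨G₃, h₃⟩⟩ =>
    ⟨ncJoin (i + 1 + k) G₁ G₂ G₃, by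
      have hp' : i + m = n := HasAntidiagonal.mem_antidiagonal.1 hp
      have hq' : k + l = m := HasAntidiagonal.mem_antidiagonal.1 hq
      rw [show 0 + (n + 1) = i + 1 + k + l by omega]
      rw [zero_add] at h₁
      exact isNCTree_ncJoin (i := i) (j := i + 1 + k) (b := i + 1 + k + l) (by omega) (by omega)
        h₁ h₂ h₃⟩

theorem bijective_ncJoinOfAntidiagonal (n : ℕ) : Function.Bijective (ncJoinOfAntidiagonal n) := by
  constructor
  · rintro ⟨⟨⟨i, m⟩, hp⟩, ⟨G₁, h₁⟩, ⟨⟨k, l⟩, hq⟩, ⟨G₂, h₂⟩, ⟨G₃, h₃⟩⟩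
      ⟨⟨⟨i', m'⟩, hp'⟩, ⟨G₁', h₁'⟩, ⟨⟨k', l'⟩, hq'⟩, ⟨G₂', h₂'⟩, ⟨G₃', h₃'⟩⟩ h
    have hm : i + m = n := Finset.HasAntidiagonal.mem_antidiagonal.1 hp
    have hm' : i' + m' = n := Finset.HasAntidiagonal.mem_antidiagonal.1 hp'
    have hl : k + l = m := Finset.HasAntidiagonal.mem_antidiagonal.1 hq
    have hl' : k' + l' = m' := Finset.HasAntidiagonal.mem_antidiagonal.1 hq'
    have e₁ : IsNCTree 0 i G₁ := by simpa only [zero_add] using h₁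
    have e₁' : IsNCTree 0 i' G₁' := by simpa only [zero_add] using h₁'
    have e₃ : IsNCTree (i + 1 + k) (n + 1) G₃ := by
      convert h₃ using 1
      dsimp only
      omega
    have e₃' : IsNCTree (i' + 1 + k') (n + 1) G₃' := by
      convert h₃' using 1
      dsimp only
      omega
    obtain ⟨rfl, hj, rfl, rfl, rfl⟩ := ncJoin_injective (i := i) (j := i + 1 + k)
      (i' := i') (j' := i' + 1 + k') (by omega) e₁ h₂ e₃ (by omega) e₁' h₂' e₃'
      (congrArg Subtype.val h)
    obtain rfl : k = k' := Nat.add_left_cancel hj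
    obtain rfl : m = m' := by omega
    obtain rfl : l = l' := by omega
    rfl
  · rintro ⟨G, hG⟩
    obtain ⟨i, j, G₁, G₂, G₃, hij, hjb, h₁, h₂, h₃, rfl⟩ := hG.exists_eq_ncJoin (by omega)
    obtain ⟨k, rfl⟩ := Nat.exists_eq_add_of_le (Nat.succ_le_of_lt hij)
    obtain ⟨l, hl⟩ := Nat.exists_eq_add_of_le hjb
    rw [← zero_add i] at h₁
    rw [hl] at h₃
    obtain rfl : n = i + (k + l) := by omega
    exact ⟨⟨⟨⟨i, k + l⟩, Finset.HasAntidiagonal.mem_antidiagonal.2 rfl⟩, ⟨G₁, h₁⟩,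
      ⟨⟨k, l⟩, Finset.HasAntidiagonal.mem_antidiagonal.2 rfl⟩, ⟨G₂, h₂⟩, ⟨G₃, h₃⟩⟩, rfl⟩

open Finset in
theorem card_noncrossingTrees_succ (t : ℕ → ℕ)
    (ht : ∀ n, t n = Nat.card {G : SimpleGraph (Fin (n + 1)) | G.IsTree ∧ G.Noncrossing}) (n : ℕ) :
    t (n + 1) = ∑ p ∈ antidiagonal n, t p.1 * ∑ q ∈ antidiagonal p.2, t q.1 * t q.2 := by
  have hc : ∀ a n, Nat.card {G : SimpleGraph ℕ // IsNCTree a (a + n) G} = t n :=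
    fun a n ↦ (Nat.card_congr (ncTreeEquiv a n)).trans (ht n).symm
  rw [← hc 0, ← Nat.card_eq_of_bijective _ (bijective_ncJoinOfAntidiagonal n), Nat.card_sigma,
    ← sum_coe_sort (antidiagonal n)]
  refine sum_congr rfl fun p _ ↦ ?_
  rw [Nat.card_prod, Nat.card_sigma, hc, ← sum_coe_sort (antidiagonal p.1.2)]
  simp only [Nat.card_prod, hc]

end SimpleGraph

/-- For every `n ≥ 1`, the number of noncrossing trees on `n` linearly ordered vertices
(simple graphs on `Fin n` that are trees and noncrossing) equals the Fuss–Catalan number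
`FC(3, n-1) = (1/(2n-1)) · C(3n-3, n-1)`. -/
theorem card_noncrossingTrees (n : ℕ) (hn : 1 ≤ n) :
    Nat.card {G : SimpleGraph (Fin n) | G.IsTree ∧ G.Noncrossing} = FC 3 (n - 1) := by
  obtain ⟨m, rfl⟩ := Nat.exists_eq_add_of_le' hn
  set t : ℕ → ℕ :=
    fun n ↦ Nat.card {G : SimpleGraph (Fin (n + 1)) | G.IsTree ∧ G.Noncrossing}
  have h0 : t 0 = 1 := by
    have : Nonempty {G : SimpleGraph (Fin (0 + 1)) | G.IsTree ∧ G.Noncrossing} :=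
      have : Subsingleton (Fin (0 + 1)) := inferInstanceAs (Subsingleton (Fin 1))
      ⟨⊥, .of_subsingleton, fun _ _ _ _ h ↦ h.elim⟩
    have : Subsingleton (SimpleGraph (Fin (0 + 1))) :=
      inferInstanceAs (Subsingleton (SimpleGraph (Fin 1)))
    exact Nat.card_unique
  have h := two_mul_add_one_mul_eq_choose_of_recurrence h0
    (SimpleGraph.card_noncrossingTrees_succ t fun _ ↦ rfl) m
  change t m = FC 3 m
  rw [FC, ← h]
  exact (Nat.mul_div_cancel_left _ (by omega)).symm
end
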